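/- There exist absolute constants C > 0 and N₀ ≥ 1 with the following property. Let u : ℝ² → ℝ be smooth with compact support contained in {(τ,s) : τ > 0 and s > 1}, let N ≥ N₀ be real, and define h(τ,s) = τ^{−2}·( τ·∂_τ u − ∂²_s u − s·∂_s u + N·u )(τ,s) on {τ > 0}. Then ∬ (τ·∂_τ u)² + (∂²_s u)² dτ ds + ∬ s²·(∂_s u)² + N·(∂_s u)² + N²·u² dτ ds + N·∬ s²·u² dτ ds ≤ C·∬ s²·τ⁴·h² dτ ds, where all integrals are over (0,∞)×(1,∞). -/

import Mathlib

open Set MeasureTheory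

/-- Partial derivative in the first variable. -/
noncomputable def pd1 (u : ℝ × ℝ → ℝ) (p : ℝ × ℝ) : ℝ :=
  deriv (fun t => u (t, p.2)) p.1

/-- Partial derivative in the second variable. -/
noncomputable def pd2 (u : ℝ × ℝ → ℝ) (p : ℝ × ℝ) : ℝ :=
  deriv (fun s => u (p.1, s)) p.2

lemma hasDerivAt_slice_fst {g : ℝ × ℝ → ℝ} (hg : Differentiable ℝ g) (p : ℝ × ℝ) :
    HasDerivAt (fun t => g (t, p.2)) (fderiv ℝ g p (1, 0)) p.1 :=
  (hg p).hasFDerivAt.comp_hasDerivAt (f := fun t : ℝ => (t, p.2)) p.1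
    ((hasDerivAt_id p.1).prodMk (hasDerivAt_const p.1 p.2))

lemma hasDerivAt_slice_snd {g : ℝ × ℝ → ℝ} (hg : Differentiable ℝ g) (p : ℝ × ℝ) :
    HasDerivAt (fun s => g (p.1, s)) (fderiv ℝ g p (0, 1)) p.2 :=
  (hg p).hasFDerivAt.comp_hasDerivAt (f := fun s : ℝ => (p.1, s)) p.2
    ((hasDerivAt_const p.2 p.1).prodMk (hasDerivAt_id p.2))

lemma pd1_eq_fderiv {g : ℝ × ℝ → ℝ} (hg : Differentiable ℝ g) :
    pd1 g = fun p => fderiv ℝ g p (1, 0) :=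
  funext fun p => (hasDerivAt_slice_fst hg p).deriv

lemma pd2_eq_fderiv {g : ℝ × ℝ → ℝ} (hg : Differentiable ℝ g) :
    pd2 g = fun p => fderiv ℝ g p (0, 1) :=
  funext fun p => (hasDerivAt_slice_snd hg p).deriv

lemma hasDerivAt_pd1 {g : ℝ × ℝ → ℝ} (hg : Differentiable ℝ g) (p : ℝ × ℝ) :
    HasDerivAt (fun t => g (t, p.2)) (pd1 g p) p.1 :=
  (hasDerivAt_slice_fst hg p).differentiableAt.hasDerivAt

lemma hasDerivAt_pd2 {g : ℝ × ℝ → ℝ} (hg : Differentiable ℝ g) (p : ℝ × ℝ) :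
    HasDerivAt (fun s => g (p.1, s)) (pd2 g p) p.2 :=
  (hasDerivAt_slice_snd hg p).differentiableAt.hasDerivAt

lemma contDiff_pd1 {g : ℝ × ℝ → ℝ} (hg : ContDiff ℝ (⊤ : ℕ∞) g) :
    ContDiff ℝ (⊤ : ℕ∞) (pd1 g) := by
  rw [pd1_eq_fderiv (hg.differentiable (by simp))]
  exact (hg.fderiv_right (m := (⊤ : ℕ∞)) (by simp)).clm_apply contDiff_const

lemma contDiff_pd2 {g : ℝ × ℝ → ℝ} (hg : ContDiff ℝ (⊤ : ℕ∞) g) :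
    ContDiff ℝ (⊤ : ℕ∞) (pd2 g) := by
  rw [pd2_eq_fderiv (hg.differentiable (by simp))]
  exact (hg.fderiv_right (m := (⊤ : ℕ∞)) (by simp)).clm_apply contDiff_const

lemma tsupport_pd1_subset {g : ℝ × ℝ → ℝ} (hg : Differentiable ℝ g) :
    tsupport (pd1 g) ⊆ tsupport g := by
  rw [pd1_eq_fderiv hg]
  exact tsupport_fderiv_apply_subset ℝ (1, 0)

lemma tsupport_pd2_subset {g : ℝ × ℝ → ℝ} (hg : Differentiable ℝ g) :
    tsupport (pd2 g) ⊆ tsupport g := by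
  rw [pd2_eq_fderiv hg]
  exact tsupport_fderiv_apply_subset ℝ (0, 1)

lemma pd1_pd2_comm {g : ℝ × ℝ → ℝ} (hg : ContDiff ℝ (⊤ : ℕ∞) g) (p : ℝ × ℝ) :
    pd1 (pd2 g) p = pd2 (pd1 g) p := by
  have hd : Differentiable ℝ g := hg.differentiable (by simp)
  have hd' : DifferentiableAt ℝ (fderiv ℝ g) p :=
    (hg.fderiv_right (m := (⊤ : ℕ∞)) (by simp)).differentiable (by simp) p
  rw [pd1_eq_fderiv ((contDiff_pd2 hg).differentiable (by simp)),
    pd2_eq_fderiv ((contDiff_pd1 hg).differentiable (by simp)),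
    pd1_eq_fderiv hd, pd2_eq_fderiv hd]
  have key (v w : ℝ × ℝ) :
      fderiv ℝ (fun q => fderiv ℝ g q v) p w = fderiv ℝ (fderiv ℝ g) p w v := by
    rw [fderiv_clm_apply hd' (differentiableAt_const v)]
    simp
  simp only [key]
  exact hg.contDiffAt.isSymmSndFDerivAt
    (minSmoothness_of_isRCLikeNormedField.trans_le (WithTop.coe_le_coe.2 (le_top (a := (2 : ℕ∞))))) _ _

lemma integral_pd1_eq_zero {g : ℝ × ℝ → ℝ} (hg : ContDiff ℝ (⊤ : ℕ∞) g)
    (hc : HasCompactSupport g) : ∫ p, pd1 g p = 0 := by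
  have hd : Differentiable ℝ g := hg.differentiable (by simp)
  have hc1 : HasCompactSupport (pd1 g) := hc.mono' (subset_closure.trans (tsupport_pd1_subset hd))
  have hi := (contDiff_pd1 hg).continuous.integrable_of_hasCompactSupport (μ := volume) hc1
  have slice (s : ℝ) {f : ℝ × ℝ → ℝ} (hf : Continuous f) (hcf : HasCompactSupport f) :
      Integrable (fun t => f (t, s)) := by
    refine Continuous.integrable_of_hasCompactSupport (by fun_prop)
      (.intro (hcf.isCompact.image continuous_fst) fun t ht => ?_)
    by_contra hne
    exact ht ⟨(t, s), subset_tsupport f hne, rfl⟩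
  rw [Measure.volume_eq_prod] at hi ⊢
  rw [integral_prod_symm _ hi]
  refine integral_eq_zero_of_ae (.of_forall fun s => ?_)
  exact integral_eq_zero_of_hasDerivAt_of_integrable (fun t => hasDerivAt_pd1 hd (t, s))
    (slice s (contDiff_pd1 hg).continuous hc1) (slice s hg.continuous hc)

lemma integral_pd2_eq_zero {g : ℝ × ℝ → ℝ} (hg : ContDiff ℝ (⊤ : ℕ∞) g)
    (hc : HasCompactSupport g) : ∫ p, pd2 g p = 0 := by
  have hd : Differentiable ℝ g := hg.differentiable (by simp)
  have hc2 : HasCompactSupport (pd2 g) := hc.mono' (subset_closure.trans (tsupport_pd2_subset hd))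
  have hi := (contDiff_pd2 hg).continuous.integrable_of_hasCompactSupport (μ := volume) hc2
  have slice (t : ℝ) {f : ℝ × ℝ → ℝ} (hf : Continuous f) (hcf : HasCompactSupport f) :
      Integrable (fun s => f (t, s)) := by
    refine Continuous.integrable_of_hasCompactSupport (by fun_prop)
      (.intro (hcf.isCompact.image continuous_snd) fun s hs => ?_)
    by_contra hne
    exact hs ⟨(t, s), subset_tsupport f hne, rfl⟩
  rw [Measure.volume_eq_prod] at hi ⊢
  rw [integral_prod _ hi]
  refine integral_eq_zero_of_ae (.of_forall fun t => ?_)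
  exact integral_eq_zero_of_hasDerivAt_of_integrable (fun s => hasDerivAt_pd2 hd (t, s))
    (slice t (contDiff_pd2 hg).continuous hc2) (slice t hg.continuous hc)

/-- First component of the vector field whose divergence collects the boundary terms of the
multiplier identities. -/
noncomputable def fluxFst (u : ℝ × ℝ → ℝ) (N : ℝ) (p : ℝ × ℝ) : ℝ :=
  -5 * (p.1 * p.2 ^ 2 * u p ^ 2 / 2) - 8 * N * (p.1 * u p ^ 2 / 2) - p.1 * pd2 u p ^ 2

/-- Second component of the vector field whose divergence collects the boundary terms of the
multiplier identities. -/
noncomputable def fluxSnd (u : ℝ × ℝ → ℝ) (N : ℝ) (p : ℝ × ℝ) : ℝ :=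
  -5 * (-(p.2 ^ 2 * u p * pd2 u p) + p.2 * u p ^ 2 - p.2 ^ 3 * u p ^ 2 / 2)
    - 8 * N * (-(u p * pd2 u p) - p.2 * u p ^ 2 / 2) + 2 * p.1 * pd1 u p * pd2 u p

lemma pd1_fluxFst {u : ℝ × ℝ → ℝ} (hu : ContDiff ℝ (⊤ : ℕ∞) u) (N : ℝ) (p : ℝ × ℝ) :
    pd1 (fluxFst u N) p =
      -5 * (p.2 ^ 2 * u p ^ 2 / 2 + p.1 * p.2 ^ 2 * u p * pd1 u p)
        - 8 * N * (u p ^ 2 / 2 + p.1 * u p * pd1 u p)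
        - (pd2 u p ^ 2 + 2 * p.1 * pd2 u p * pd1 (pd2 u) p) := by
  have h1 := hasDerivAt_pd1 (hu.differentiable (by simp)) p
  have h2 := hasDerivAt_pd1 ((contDiff_pd2 hu).differentiable (by simp)) p
  have ht := hasDerivAt_id p.1
  refine HasDerivAt.deriv (f := fun t => fluxFst u N (t, p.2)) ?_
  refine HasDerivAt.congr_deriv
    ((((((ht.mul_const (p.2 ^ 2)).mul (h1.pow 2)).div_const 2).const_mul (-5)).sub
    (((ht.mul (h1.pow 2)).div_const 2).const_mul (8 * N))).sub (ht.mul (h2.pow 2))) ?_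
  simp
  ring

lemma pd2_fluxSnd {u : ℝ × ℝ → ℝ} (hu : ContDiff ℝ (⊤ : ℕ∞) u) (N : ℝ) (p : ℝ × ℝ) :
    pd2 (fluxSnd u N) p =
      -5 * (-(p.2 ^ 2 * pd2 u p ^ 2) - p.2 ^ 2 * u p * pd2 (pd2 u) p + u p ^ 2
          - 3 / 2 * p.2 ^ 2 * u p ^ 2 - p.2 ^ 3 * u p * pd2 u p)
        - 8 * N * (-(pd2 u p ^ 2) - u p * pd2 (pd2 u) p - u p ^ 2 / 2 - p.2 * u p * pd2 u p)
        + 2 * p.1 * (pd2 (pd1 u) p * pd2 u p + pd1 u p * pd2 (pd2 u) p) := by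
  have h1 := hasDerivAt_pd2 (hu.differentiable (by simp)) p
  have h2 := hasDerivAt_pd2 ((contDiff_pd2 hu).differentiable (by simp)) p
  have h3 := hasDerivAt_pd2 ((contDiff_pd1 hu).differentiable (by simp)) p
  have hs := hasDerivAt_id p.2
  refine HasDerivAt.deriv (f := fun s => fluxSnd u N (p.1, s)) ?_
  refine HasDerivAt.congr_deriv
    ((((((((hs.pow 2).mul h1).mul h2).neg.add (hs.mul (h1.pow 2))).sub
      (((hs.pow 3).mul (h1.pow 2)).div_const 2)).const_mul (-5)).sub
    (((h1.mul h2).neg.sub ((hs.mul (h1.pow 2)).div_const 2)).const_mul (8 * N))).add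
    ((h3.const_mul (2 * p.1)).mul h2)) ?_
  simp
  ring

/-- The pointwise inequality behind the estimate: here `a, v, w, x` stand for
`u, ∂_s u, ∂²_s u, τ∂_τ u` and `f` for the right-hand side of the equation. -/
lemma pointwise_estimate {N s a v w x f : ℝ} (hN : 1 ≤ N) (hs : 1 ≤ s)
    (hf : f = x - w - s * v + N * a) :
    (x ^ 2 + w ^ 2) + (s ^ 2 * v ^ 2 + N * v ^ 2 + N ^ 2 * a ^ 2) + N * (s ^ 2 * a ^ 2) ≤
      10 * (s ^ 2 * f ^ 2) + 2 * x * w - v ^ 2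
        + 5 * (s ^ 2 * v ^ 2 + (N + 1) * s ^ 2 * a ^ 2 - a ^ 2 - s ^ 2 * a * f)
        + 8 * N * (v ^ 2 + N * a ^ 2 - a * f) := by
  have hs2 : 1 ≤ s ^ 2 := one_le_pow₀ hs
  have hsq : (x - w) ^ 2 ≤ 3 * f ^ 2 + 3 * (s ^ 2 * v ^ 2) + 3 * (N ^ 2 * a ^ 2) := by
    have : x - w = f + s * v - N * a := by rw [hf]; ring
    rw [this]
    nlinarith [sq_nonneg (f - s * v), sq_nonneg (f + N * a), sq_nonneg (s * v + N * a)]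
  have hs2a : s ^ 2 * a * f ≤ N * (s ^ 2 * a ^ 2) / 2 + s ^ 2 * f ^ 2 / 2 := by
    have h1 := mul_nonneg (sq_nonneg s) (sq_nonneg (a - f))
    have h2 := mul_nonneg (sub_nonneg.2 hN) (mul_nonneg (sq_nonneg s) (sq_nonneg a))
    linarith
  have hNa : N * (a * f) ≤ N ^ 2 * a ^ 2 / 2 + f ^ 2 / 2 := by
    linarith [sq_nonneg (N * a - f)]
  have hff := mul_nonneg (sub_nonneg.2 hs2) (sq_nonneg f)
  have hvv := mul_nonneg (sub_nonneg.2 hs2) (sq_nonneg v)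
  have haa := mul_nonneg (sub_nonneg.2 hs2) (sq_nonneg a)
  have hNv := mul_nonneg (zero_le_one.trans hN) (sq_nonneg v)
  have hNsa := mul_nonneg (zero_le_one.trans hN) (mul_nonneg (sq_nonneg s) (sq_nonneg a))
  nlinarith

/-- Full a priori estimate for the model operator `τ∂_τ − ∂²_s − s∂_s + N` near the
corner of the front and bottom faces:
`∬ (τ∂_τ u)² + (∂²_s u)² + ∬ s²(∂_s u)² + N(∂_s u)² + N²u² + N ∬ s²u² ≤ C ∬ s²τ⁴h²`. -/
theorem model_full_estimate_I :
    ∃ C : ℝ, 0 < C ∧ ∃ N₀ : ℝ, 1 ≤ N₀ ∧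
      ∀ (u h : ℝ × ℝ → ℝ) (N : ℝ), N₀ ≤ N →
        ContDiff ℝ (⊤ : ℕ∞) u → HasCompactSupport u →
        tsupport u ⊆ {p : ℝ × ℝ | 0 < p.1 ∧ 1 < p.2} →
        (∀ p : ℝ × ℝ, 0 < p.1 →
          h p = (p.1 ^ 2)⁻¹ *
            (p.1 * pd1 u p - pd2 (pd2 u) p - p.2 * pd2 u p + N * u p)) →
        (∫ p in Ioi (0:ℝ) ×ˢ Ioi (1:ℝ),
            ((p.1 * pd1 u p) ^ 2 + (pd2 (pd2 u) p) ^ 2)) +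
          (∫ p in Ioi (0:ℝ) ×ˢ Ioi (1:ℝ),
            (p.2 ^ 2 * (pd2 u p) ^ 2 + N * (pd2 u p) ^ 2 + N ^ 2 * (u p) ^ 2)) +
          N * (∫ p in Ioi (0:ℝ) ×ˢ Ioi (1:ℝ), p.2 ^ 2 * (u p) ^ 2) ≤
          C * ∫ p in Ioi (0:ℝ) ×ˢ Ioi (1:ℝ), p.2 ^ 2 * p.1 ^ 4 * (h p) ^ 2 := by
  refine ⟨10, by norm_num, 1, le_rfl, fun u h N hN hu hc hsupp hh => ?_⟩
  have hd := hu.differentiable (by simp)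
  have hu1 := contDiff_pd1 hu
  have hu2 := contDiff_pd2 hu
  have hu22 := contDiff_pd2 hu2
  have c0 := hu.continuous
  have c1 := hu1.continuous
  have c2 := hu2.continuous
  have c22 := hu22.continuous
  have z0 : ∀ p ∉ tsupport u, u p = 0 := fun p => image_eq_zero_of_notMem_tsupport
  have z1 : ∀ p ∉ tsupport u, pd1 u p = 0 := fun p hp =>
    image_eq_zero_of_notMem_tsupport fun hp' => hp (tsupport_pd1_subset hd hp')
  have z2 : ∀ p ∉ tsupport u, pd2 u p = 0 := fun p hp =>
    image_eq_zero_of_notMem_tsupport fun hp' => hp (tsupport_pd2_subset hd hp')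
  have z22 : ∀ p ∉ tsupport u, pd2 (pd2 u) p = 0 := fun p hp =>
    image_eq_zero_of_notMem_tsupport fun hp' => hp (tsupport_pd2_subset hd
      (tsupport_pd2_subset (hu2.differentiable (by simp)) hp'))
  have hS : MeasurableSet (Ioi (0:ℝ) ×ˢ Ioi (1:ℝ)) := measurableSet_Ioi.prod measurableSet_Ioi
  have int {F : ℝ × ℝ → ℝ} (hF : Continuous F) (h0 : ∀ p ∉ tsupport u, F p = 0) :
      Integrable F := hF.integrable_of_hasCompactSupport (.intro hc h0)
  have hG1 : ContDiff ℝ (⊤ : ℕ∞) (fluxFst u N) := by unfold fluxFst; fun_prop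
  have hG2 : ContDiff ℝ (⊤ : ℕ∞) (fluxSnd u N) := by unfold fluxSnd; fun_prop
  have hc1 : HasCompactSupport (fluxFst u N) :=
    .intro hc fun p hp => by simp [fluxFst, z0 p hp, z2 p hp]
  have hc2 : HasCompactSupport (fluxSnd u N) :=
    .intro hc fun p hp => by simp [fluxSnd, z0 p hp, z2 p hp]
  have zG1 : ∀ p ∉ tsupport u, pd1 (fluxFst u N) p = 0 := fun p hp => by
    simp [pd1_fluxFst hu, z0 p hp, z2 p hp]
  have zG2 : ∀ p ∉ tsupport u, pd2 (fluxSnd u N) p = 0 := fun p hp => by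
    simp [pd2_fluxSnd hu, z0 p hp, z1 p hp, z2 p hp]
  have iG1 := int (contDiff_pd1 hG1).continuous zG1
  have iG2 := int (contDiff_pd2 hG2).continuous zG2
  have hflux : ∫ p in Ioi (0:ℝ) ×ˢ Ioi (1:ℝ),
      (pd1 (fluxFst u N) p + pd2 (fluxSnd u N) p) = 0 := by
    rw [setIntegral_eq_integral_of_forall_compl_eq_zero, integral_add iG1 iG2,
      integral_pd1_eq_zero hG1 hc1, integral_pd2_eq_zero hG2 hc2, add_zero]
    intro p hp
    have hp' : p ∉ tsupport u := fun hp' => hp (hsupp hp')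
    rw [zG1 p hp', zG2 p hp', add_zero]
  have hrhs : ∫ p in Ioi (0:ℝ) ×ˢ Ioi (1:ℝ), p.2 ^ 2 * p.1 ^ 4 * (h p) ^ 2 =
      ∫ p in Ioi (0:ℝ) ×ˢ Ioi (1:ℝ), p.2 ^ 2 *
        (p.1 * pd1 u p - pd2 (pd2 u) p - p.2 * pd2 u p + N * u p) ^ 2 := by
    refine setIntegral_congr_fun hS fun p hp => ?_
    have hp1 : p.1 ≠ 0 := (mem_Ioi.1 hp.1).ne'
    simp only [hh p hp.1]
    field_simp
  have i1 : Integrable fun p : ℝ × ℝ => (p.1 * pd1 u p) ^ 2 + (pd2 (pd2 u) p) ^ 2 :=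
    int (by fun_prop) fun p hp => by simp [z1 p hp, z22 p hp]
  have i2 : Integrable fun p : ℝ × ℝ =>
      p.2 ^ 2 * (pd2 u p) ^ 2 + N * (pd2 u p) ^ 2 + N ^ 2 * (u p) ^ 2 :=
    int (by fun_prop) fun p hp => by simp [z0 p hp, z2 p hp]
  have i3 : Integrable fun p : ℝ × ℝ => N * (p.2 ^ 2 * (u p) ^ 2) :=
    int (by fun_prop) fun p hp => by simp [z0 p hp]
  have i4 : Integrable fun p : ℝ × ℝ => 10 * (p.2 ^ 2 *
      (p.1 * pd1 u p - pd2 (pd2 u) p - p.2 * pd2 u p + N * u p) ^ 2) :=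
    int (by fun_prop) fun p hp => by simp [z0 p hp, z1 p hp, z2 p hp, z22 p hp]
  have i12 : Integrable fun p : ℝ × ℝ => (p.1 * pd1 u p) ^ 2 + (pd2 (pd2 u) p) ^ 2 +
      (p.2 ^ 2 * (pd2 u p) ^ 2 + N * (pd2 u p) ^ 2 + N ^ 2 * (u p) ^ 2) := i1.add i2
  rw [hrhs, ← integral_const_mul, ← integral_const_mul,
    ← integral_add i1.integrableOn i2.integrableOn,
    ← integral_add i12.integrableOn i3.integrableOn]
  refine (setIntegral_mono_on (i12.add i3).integrableOn
    (i4.add (iG1.add iG2)).integrableOn hS fun p hp => ?_).trans_eq ?_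
  · refine (pointwise_estimate hN (mem_Ioi.1 hp.2).le rfl).trans_eq ?_
    simp only [Pi.add_apply, pd1_fluxFst hu, pd2_fluxSnd hu, pd1_pd2_comm hu]
    ring
  · exact (integral_add i4.integrableOn (iG1.add iG2).integrableOn).trans
      ((congrArg _ hflux).trans (add_zero _))
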